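/- arXiv:2307.16421 — 5 statements merged into one kernel-verified Lean document; each statement's English description precedes it below -/
import Mathlib

section
/- Let φ : ℝ^d → ℝ be strictly convex such that ∇φ : ℝ^d → ℝ^d is a C² diffeomorphism (both ∇φ and its inverse are twice continuously differentiable). Then for every j ∈ {1,…,d} and every x ∈ ℝ^d, the derivative of log det ∇²φ with respect to the j-th mirror coordinate x^φ_j equals minus the sum of the mixed derivatives ∂²x_j/∂x_ℓ∂x^φ_ℓ; explicitly, Σ_{ℓ=1}^d ((∇²φ(x))^{-1})_{ℓ j} · ∂_{x_ℓ}[log det ∇²φ](x) = − Σ_{ℓ=1}^d ∂_{x_ℓ}[ x ↦ ((∇²φ(x))^{-1})_{j ℓ} ](x). -/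
open MeasureTheory Filter
open scoped RealInnerProductSpace BigOperators Topology

noncomputable section

/-- Euclidean space `ℝ^d`. -/
abbrev E (d : ℕ) := EuclideanSpace ℝ (Fin d)

/-- Hessian matrix of `φ` at `x`, with entries `∂²φ/∂xᵢ∂xⱼ (x)`. -/
def hessian {d : ℕ} (φ : E d → ℝ) (x : E d) : Matrix (Fin d) (Fin d) ℝ :=
  fun i j =>
    fderiv ℝ (fun z => fderiv ℝ φ z (EuclideanSpace.single j 1)) x (EuclideanSpace.single i 1)

section MatrixCalculus

variable {F n : Type*} [NormedAddCommGroup F] [NormedSpace ℝ F] [Fintype n] [DecidableEq n]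
  {A : F → Matrix n n ℝ} {x : F}

/-- Jacobi's formula for the derivative of the determinant. -/
theorem hasFDerivAt_det_of_entries {A' : n → n → F →L[ℝ] ℝ}
    (hA : ∀ i j, HasFDerivAt (fun z => A z i j) (A' i j) x) :
    HasFDerivAt (fun z => (A z).det) (∑ i, ∑ j, (A x).adjugate j i • A' i j) x := by
  let D : ContinuousMultilinearMap ℝ (fun _ : n => n → ℝ) ℝ :=
    ⟨(Matrix.detRowAlternating (n := n) (R := ℝ)).toMultilinearMap,
      Continuous.matrix_det continuous_id⟩
  have hpi : HasFDerivAt (F := n → n → ℝ) (fun z i j => A z i j)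
      (ContinuousLinearMap.pi fun i => ContinuousLinearMap.pi fun j => A' i j) x :=
    hasFDerivAt_pi.2 fun i => hasFDerivAt_pi.2 fun j => hA i j
  have h := (D.hasFDerivAt (x := fun i j => A x i j)).comp x hpi
  refine h.congr_fderiv ?_
  ext v
  simp only [ContinuousLinearMap.comp_apply, ContinuousMultilinearMap.linearDeriv_apply,
    ContinuousLinearMap.coe_pi', sum_apply, smul_apply, smul_eq_mul]
  refine Finset.sum_congr rfl fun i _ => ?_
  change ((A x).updateRow i fun j => A' i j v).det = _
  rw [Matrix.det_eq_sum_mul_adjugate_row _ i]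
  refine Finset.sum_congr rfl fun j _ => ?_
  simp [Matrix.adjugate_apply, mul_comm]

theorem fderiv_log_det (hA : ∀ i j, DifferentiableAt ℝ (fun z => A z i j) x)
    (hdet : (A x).det ≠ 0) (v : F) :
    fderiv ℝ (fun z => Real.log (A z).det) x v =
      ∑ i, ∑ j, (A x)⁻¹ j i * fderiv ℝ (fun z => A z i j) x v := by
  rw [((hasFDerivAt_det_of_entries fun i j => (hA i j).hasFDerivAt).log hdet).fderiv]
  simp [Matrix.inv_def, Finset.mul_sum, mul_assoc]

theorem differentiableAt_matrix_inv (hA : ∀ i j, DifferentiableAt ℝ (fun z => A z i j) x)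
    (hdet : (A x).det ≠ 0) (i j : n) : DifferentiableAt ℝ (fun z => (A z)⁻¹ i j) x := by
  have hadj : DifferentiableAt ℝ (fun z => (A z).adjugate i j) x := by
    simp only [Matrix.adjugate_apply]
    refine (hasFDerivAt_det_of_entries
      (A' := fun a b => fderiv ℝ (fun z => (A z).updateRow j (Pi.single i 1) a b) x)
      fun a b => DifferentiableAt.hasFDerivAt ?_).differentiableAt
    by_cases h : a = j
    · subst h; simp
    · simpa [h] using hA a b
  have hd := (hasFDerivAt_det_of_entries fun i j => (hA i j).hasFDerivAt).differentiableAt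
  simpa [Matrix.inv_def] using (hd.fun_inv hdet).fun_mul hadj

theorem fderiv_matrix_inv (hA : ∀ i j, DifferentiableAt ℝ (fun z => A z i j) x)
    (hdet : ∀ z, (A z).det ≠ 0) (v : F) (i j : n) :
    fderiv ℝ (fun z => (A z)⁻¹ i j) x v =
      -∑ a, ∑ b, (A x)⁻¹ i a * fderiv ℝ (fun z => A z a b) x v * (A x)⁻¹ b j := by
  let B : Matrix n n ℝ := fun i j => fderiv ℝ (fun z => (A z)⁻¹ i j) x v
  let C : Matrix n n ℝ := fun i j => fderiv ℝ (fun z => A z i j) x v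
  have hinv := differentiableAt_matrix_inv hA (hdet x)
  have hBC : B * A x + (A x)⁻¹ * C = 0 := by
    ext a c
    have hconst : (fun z => ∑ b, (A z)⁻¹ a b * A z b c) = fun _ => (1 : Matrix n n ℝ) a c := by
      funext z
      rw [← Matrix.mul_apply, Matrix.nonsing_inv_mul _ (hdet z).isUnit]
    have h := HasFDerivAt.fun_sum (u := Finset.univ) fun b _ =>
      (hinv a b).hasFDerivAt.mul (hA b c).hasFDerivAt
    have h' := congrArg (fun L => L v) (h.unique (hconst ▸ hasFDerivAt_const _ x))
    simp only [sum_apply, add_apply, smul_apply, smul_eq_mul, Finset.sum_add_distrib,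
      zero_apply] at h'
    rw [Matrix.add_apply, Matrix.mul_apply, Matrix.mul_apply, Matrix.zero_apply, ← h', add_comm]
    simp only [B, C, mul_comm]
  have hB : B = -((A x)⁻¹ * C * (A x)⁻¹) := by
    rw [← Matrix.neg_mul, ← eq_neg_of_add_eq_zero_left hBC,
      Matrix.mul_nonsing_inv_cancel_right _ _ (hdet x).isUnit]
  change B i j = _
  rw [hB, Matrix.neg_apply, Matrix.mul_apply]
  simp only [Matrix.mul_apply, Finset.sum_mul]
  rw [Finset.sum_comm]

end MatrixCalculus

section Hessian

variable {d : ℕ} {φ : E d → ℝ}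

theorem gradient_coord (φ : E d → ℝ) (x : E d) (j : Fin d) :
    gradient φ x j = fderiv ℝ φ x (EuclideanSpace.single j 1) := by
  rw [← inner_gradient_left, EuclideanSpace.inner_single_right]
  simp

theorem hessian_apply (φ : E d → ℝ) (x : E d) (i j : Fin d) :
    hessian φ x i j =
      fderiv ℝ (fun z => gradient φ z j) x (EuclideanSpace.single i 1) := by
  simp only [hessian, gradient_coord]

theorem hessian_symm_of_gradient_ne_zero (hgrad : ContDiff ℝ 2 fun x => gradient φ x)
    {x : E d} (hx : gradient φ x ≠ 0) (i j : Fin d) :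
    hessian φ x i j = hessian φ x j i := by
  have hφ : ∀ᶠ y in 𝓝 x, HasFDerivAt φ (fderiv ℝ φ y) y := by
    filter_upwards [hgrad.continuous.continuousAt.eventually_ne hx] with y hy
    by_contra h
    exact hy (gradient_eq_zero_of_not_differentiableAt fun h' => h h'.hasFDerivAt)
  have hd : DifferentiableAt ℝ (fderiv ℝ φ) x := by
    rw [← toDual_comp_gradient]
    exact (InnerProductSpace.toDual ℝ (E d)).differentiableAt.comp x
      (hgrad.differentiable (by norm_num) x)
  have happ (a b : Fin d) : hessian φ x a b = fderiv ℝ (fderiv ℝ φ) x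
      (EuclideanSpace.single a 1) (EuclideanSpace.single b 1) := by
    simp [hessian, fderiv_clm_apply hd (differentiableAt_const _)]
  rw [happ, happ]
  exact second_derivative_symmetric_of_eventually hφ hd.hasFDerivAt _ _

theorem contDiff_gradient_coord (hgrad : ContDiff ℝ 2 fun x => gradient φ x) (j : Fin d) :
    ContDiff ℝ 2 fun x => gradient φ x j :=
  (contDiff_piLp 2).1 hgrad j

theorem contDiff_hessian (hgrad : ContDiff ℝ 2 fun x => gradient φ x) (i j : Fin d) :
    ContDiff ℝ 1 fun x => hessian φ x i j := by
  simp only [hessian_apply]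
  exact ((contDiff_gradient_coord hgrad j).fderiv_right (by norm_num)).clm_apply contDiff_const

/-- The Hessian is symmetric as soon as the gradient is `C²` and injective: `φ` can only fail to be
differentiable where the gradient vanishes, and this happens at most once. -/
theorem hessian_symm (hgrad : ContDiff ℝ 2 fun x => gradient φ x)
    (hinj : Function.Injective (gradient φ)) (x : E d) (i j : Fin d) :
    hessian φ x i j = hessian φ x j i := by
  by_cases hx : gradient φ x = 0
  · have : Nonempty (Fin d) := ⟨i⟩
    have hdense : Dense ({x}ᶜ : Set (E d)) := dense_compl_singleton x
    refine congrFun (Continuous.ext_on hdense (contDiff_hessian hgrad i j).continuous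
      (contDiff_hessian hgrad j i).continuous fun y hy => ?_) x
    exact hessian_symm_of_gradient_ne_zero hgrad (fun h => hy (hinj (h.trans hx.symm))) i j
  · exact hessian_symm_of_gradient_ne_zero hgrad hx i j

theorem hessian_det_ne_zero {ψ : E d → E d} (hgrad : Differentiable ℝ fun x => gradient φ x)
    (hψ : Differentiable ℝ ψ) (hli : Function.LeftInverse ψ (gradient φ)) (x : E d) :
    (hessian φ x).det ≠ 0 := by
  let b := (EuclideanSpace.basisFun (Fin d) ℝ).toBasis
  let P := fderiv ℝ ψ (gradient φ x)
  let Q := fderiv ℝ (gradient φ) x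
  have hcomp : P.comp Q = ContinuousLinearMap.id ℝ (E d) := by
    rw [← fderiv_comp x (hψ _) (hgrad x), hli.comp_eq_id, fderiv_id]
  have hmat : LinearMap.toMatrix b b Q.toLinearMap = (hessian φ x).transpose := by
    ext i j
    have h := (PiLp.hasFDerivAt_apply (𝕜 := ℝ) 2 (gradient φ x) i).comp x (hgrad x).hasFDerivAt
    rw [Matrix.transpose_apply, hessian_apply]
    change _ = fderiv ℝ ((fun y : E d => y i) ∘ gradient φ) x _
    rw [h.fderiv]
    simp [LinearMap.toMatrix_apply, b, Q]
  have hone : LinearMap.toMatrix b b P.toLinearMap * (hessian φ x).transpose = 1 := by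
    rw [← hmat, ← LinearMap.toMatrix_comp, ← ContinuousLinearMap.toLinearMap_comp, hcomp]
    exact LinearMap.toMatrix_id b
  have hdet := congrArg Matrix.det hone
  rw [Matrix.det_mul, Matrix.det_transpose, Matrix.det_one] at hdet
  exact right_ne_zero_of_mul_eq_one hdet

theorem fderiv_hessian_swap (hgrad : ContDiff ℝ 2 fun x => gradient φ x) (x : E d)
    (a b k : Fin d) :
    fderiv ℝ (fun z => hessian φ z b k) x (EuclideanSpace.single a 1) =
      fderiv ℝ (fun z => hessian φ z a k) x (EuclideanSpace.single b 1) := by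
  have hk := contDiff_gradient_coord hgrad k
  have hd : DifferentiableAt ℝ (fderiv ℝ fun z => gradient φ z k) x :=
    (hk.fderiv_right (m := 1) (by norm_num)).differentiable (by norm_num) x
  simp only [hessian_apply, fderiv_clm_apply hd (differentiableAt_const _)]
  simpa using second_derivative_symmetric
    (fun y => (hk.differentiable (by norm_num) y).hasFDerivAt) hd.hasFDerivAt
    (EuclideanSpace.single a 1) (EuclideanSpace.single b 1)

end Hessian

/-- Let `φ : ℝ^d → ℝ` be strictly convex with `∇φ` a `C²`
diffeomorphism of `ℝ^d` (both `∇φ` and its inverse `ψ` are twice continuously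
differentiable).  Then for every `j` and every `x`, the derivative of
`log det ∇²φ` with respect to the `j`-th mirror coordinate equals minus the sum
of mixed derivatives `∂²xⱼ/∂x_ℓ ∂x^φ_ℓ`:
`∑ ℓ ((∇²φ x)⁻¹)_{ℓ j} ∂_{x_ℓ}[log det ∇²φ](x)
  = - ∑ ℓ ∂_{x_ℓ}[ z ↦ ((∇²φ z)⁻¹)_{j ℓ} ](x)`. -/
theorem mirror_derivative_logdet_hessian
    {d : ℕ} (φ : E d → ℝ) (ψ : E d → E d)
    (hconv : StrictConvexOn ℝ Set.univ φ)
    (hgrad : ContDiff ℝ 2 fun x => gradient φ x)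
    (hψ : ContDiff ℝ 2 ψ)
    (hli : Function.LeftInverse ψ (gradient φ))
    (hri : Function.RightInverse ψ (gradient φ)) :
    ∀ j : Fin d, ∀ x : E d,
      ∑ ℓ : Fin d,
          ((hessian φ x)⁻¹) ℓ j *
            fderiv ℝ (fun z => Real.log (hessian φ z).det) x (EuclideanSpace.single ℓ 1)
        = - ∑ ℓ : Fin d,
            fderiv ℝ (fun z => ((hessian φ z)⁻¹) j ℓ) x (EuclideanSpace.single ℓ 1) := by
  intro j x
  have hdiff (i k : Fin d) : DifferentiableAt ℝ (fun z => hessian φ z i k) x :=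
    (contDiff_hessian hgrad i k).differentiable (by norm_num) x
  have hdet := hessian_det_ne_zero (hgrad.differentiable (by norm_num))
    (hψ.differentiable (by norm_num)) hli
  have hsymm (a b : Fin d) : (hessian φ x)⁻¹ a b = (hessian φ x)⁻¹ b a := by
    have h : (hessian φ x).IsSymm := Matrix.IsSymm.ext fun a b =>
      hessian_symm hgrad hli.injective x b a
    exact h.inv.apply b a
  simp only [fderiv_log_det hdiff (hdet x), fderiv_matrix_inv hdiff hdet, Finset.sum_neg_distrib,
    neg_neg, Finset.mul_sum]
  conv_rhs => rw [Finset.sum_comm]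
  refine Finset.sum_congr rfl fun a _ => Finset.sum_congr rfl fun l _ =>
    Finset.sum_congr rfl fun b _ => ?_
  rw [fderiv_hessian_swap hgrad x l a b, hsymm a j]
  ring
end
end

section
/- Let w : ℝ^d → ℝ be a C³ strictly convex function whose gradient ∇w is a diffeomorphism of ℝ^d, let g : ℝ^d → ℝ be C¹ with e^{-g} a probability density, and define h : ℝ^d → ℝ by h(∇w(y)) = g(y) + log det ∇²w(y) (so that e^{-h} is the density of the pushforward of e^{-g} by ∇w). Then for every φ ∈ C²(ℝ^d) and every y ∈ ℝ^d the Sinkhorn-diffusion generator has the divergence form −⟨∇φ(y), ∇h(∇w(y))⟩ + tr( (∇²w(y))^{-1} ∇²φ(y) ) = e^{g(y)} · div( y ↦ e^{-g(y)} (∇²w(y))^{-1} ∇φ(y) )(y). Consequently, if φ is in addition compactly supported, then ∫_{ℝ^d} [ −⟨∇φ(y), ∇h(∇w(y))⟩ + tr( (∇²w(y))^{-1} ∇²φ(y) ) ] e^{-g(y)} dy = 0, i.e., e^{-g} is a stationary distribution for this generator. -/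
open MeasureTheory Filter
open scoped RealInnerProductSpace BigOperators Topology

noncomputable section

section EuclideanCalculus

variable {d : ℕ}

lemma gradient_apply_eq_fderiv (f : E d → ℝ) (y : E d) (j : Fin d) :
    gradient f y j = fderiv ℝ f y (EuclideanSpace.single j 1) := by
  rw [← toDual_gradient, InnerProductSpace.toDual_apply_apply,
    EuclideanSpace.inner_single_right]
  simp

lemma fderiv_apply_eq_sum_coord {F : Type*} [NormedAddCommGroup F] [NormedSpace ℝ F]
    (f : E d → F) (y v : E d) :
    fderiv ℝ f y v = ∑ i, v i • fderiv ℝ f y (EuclideanSpace.single i 1) := by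
  conv_lhs => rw [← (EuclideanSpace.basisFun (Fin d) ℝ).sum_repr v]
  simp [map_sum]

lemma contDiff_fderiv_apply {f : E d → ℝ} {m n : WithTop ℕ∞} (hf : ContDiff ℝ n f)
    (hmn : m + 1 ≤ n) (v : E d) : ContDiff ℝ m fun z => fderiv ℝ f z v :=
  (hf.fderiv_right hmn).clm_apply contDiff_const

lemma fderiv_fderiv_apply_comm {f : E d → ℝ} (hf : ContDiff ℝ 2 f) (y u v : E d) :
    fderiv ℝ (fun z => fderiv ℝ f z u) y v = fderiv ℝ (fun z => fderiv ℝ f z v) y u := by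
  have hd : DifferentiableAt ℝ (fderiv ℝ f) y :=
    (hf.fderiv_right (m := 1) (by norm_num)).differentiable (by norm_num) y
  have hs : IsSymmSndFDerivAt ℝ f y := hf.contDiffAt.isSymmSndFDerivAt (by simp)
  rw [fderiv_clm_apply hd (differentiableAt_const u), fderiv_clm_apply hd (differentiableAt_const v)]
  simpa using hs.eq v u

lemma hessian_symm_s16 {f : E d → ℝ} (hf : ContDiff ℝ 2 f) (y : E d) (i j : Fin d) :
    hessian f y i j = hessian f y j i :=
  fderiv_fderiv_apply_comm hf y _ _

lemma contDiff_hessian_apply {f : E d → ℝ} (hf : ContDiff ℝ 3 f) (i j : Fin d) :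
    ContDiff ℝ 1 fun z => hessian f z i j :=
  contDiff_fderiv_apply (n := 2)
    (contDiff_fderiv_apply hf (by norm_num) _) (by norm_num) _

/-- The third partial derivatives of a `C³` function are symmetric. -/
lemma fderiv_hessian_apply_comm {f : E d → ℝ} (hf : ContDiff ℝ 3 f) (y : E d) (i k l : Fin d) :
    fderiv ℝ (fun z => hessian f z k l) y (EuclideanSpace.single i 1)
      = fderiv ℝ (fun z => hessian f z k i) y (EuclideanSpace.single l 1) := by
  have h2 : ContDiff ℝ 2 f := hf.of_le (by norm_num)
  have hk : ContDiff ℝ 2 fun z => fderiv ℝ f z (EuclideanSpace.single k 1) :=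
    contDiff_fderiv_apply hf (by norm_num) _
  simp_rw [hessian_symm_s16 h2 _ k]
  exact fderiv_fderiv_apply_comm hk y _ _

/-- The integral of a directional derivative of a compactly supported `C¹` function vanishes. -/
lemma integral_fderiv_apply_eq_zero {F : E d → ℝ} (hF : ContDiff ℝ 1 F)
    (hc : HasCompactSupport F) (v : E d) : ∫ y, fderiv ℝ F y v = 0 := by
  have hint : Integrable fun y => fderiv ℝ F y v :=
    ((contDiff_fderiv_apply (m := 0) hF (by norm_num) v).continuous).integrable_of_hasCompactSupport
      (hc.fderiv_apply ℝ v)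
  have hF0 : Integrable F := hF.continuous.integrable_of_hasCompactSupport hc
  have := integral_mul_fderiv_eq_neg_fderiv_mul_of_integrable (μ := (volume : Measure (E d)))
    (f := fun _ => (1 : ℝ)) (g := F) (v := v) (by simp) (by simpa using hint) (by simpa using hF0)
    (fun _ _ => differentiableAt_const _) (fun x _ => hF.differentiable (by norm_num) x)
  simpa using this

end EuclideanCalculus

section MatrixCalculus

variable {V : Type*} [NormedAddCommGroup V] [NormedSpace ℝ V]
  {ι : Type*} [Fintype ι] [DecidableEq ι]

/-- The entrywise directional derivative of a matrix-valued map. -/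
def entrywiseFDeriv (M : V → Matrix ι ι ℝ) (y v : V) : Matrix ι ι ℝ :=
  Matrix.of fun i j => fderiv ℝ (fun z => M z i j) y v

lemma contDiff_matrix_det {n : WithTop ℕ∞} {M : V → Matrix ι ι ℝ}
    (hM : ∀ i j, ContDiff ℝ n fun z => M z i j) : ContDiff ℝ n fun z => (M z).det := by
  simp_rw [Matrix.det_apply']
  exact ContDiff.sum fun σ _ => contDiff_const.mul (contDiff_prod fun i _ => hM _ _)

lemma contDiff_matrix_inv_apply {n : WithTop ℕ∞} {M : V → Matrix ι ι ℝ}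
    (hM : ∀ i j, ContDiff ℝ n fun z => M z i j) (hdet : ∀ z, (M z).det ≠ 0) (i j : ι) :
    ContDiff ℝ n fun z => (M z)⁻¹ i j := by
  simp_rw [Matrix.inv_def, Ring.inverse_eq_inv', Matrix.smul_apply, Matrix.adjugate_apply,
    smul_eq_mul]
  refine ((contDiff_matrix_det hM).inv hdet).mul (contDiff_matrix_det fun k l => ?_)
  rcases eq_or_ne k j with rfl | hk
  · simpa using contDiff_const
  · simpa [Matrix.updateRow_ne hk] using hM k l

/-- **Jacobi's formula** for the derivative of a determinant. -/
lemma fderiv_matrix_det {M : V → Matrix ι ι ℝ} {y : V}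
    (hM : ∀ i j, DifferentiableAt ℝ (fun z => M z i j) y) (v : V) :
    fderiv ℝ (fun z => (M z).det) y v
      = ((M y).adjugate * entrywiseFDeriv M y v).trace := by
  let D : ContinuousMultilinearMap ℝ (fun _ : ι => ι → ℝ) ℝ :=
    { (Matrix.detRowAlternating : (ι → ℝ) [⋀^ι]→ₗ[ℝ] ℝ).toMultilinearMap with
      cont := Continuous.matrix_det (A := fun m : Matrix ι ι ℝ => m) continuous_id }
  have hf : HasFDerivAt (fun z i j => M z i j)
      (ContinuousLinearMap.pi fun i => ContinuousLinearMap.pi fun j =>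
        fderiv ℝ (fun z => M z i j) y) y :=
    hasFDerivAt_pi.2 fun i => hasFDerivAt_pi.2 fun j => (hM i j).hasFDerivAt
  have hD : HasFDerivAt (fun z => (M z).det) _ y :=
    HasFDerivAt.comp (f := fun z i j => M z i j) y (D.hasFDerivAt fun i j => M y i j) hf
  have key (i : ι) (b : ι → ℝ) :
      ((M y).updateRow i b).det = ∑ j, (M y).adjugate j i * b j := by
    rw [← Matrix.cramer_transpose_apply, Matrix.cramer_eq_adjugate_mulVec,
      ← Matrix.adjugate_transpose]
    rfl
  rw [hD.fderiv, ContinuousLinearMap.comp_apply, ContinuousMultilinearMap.linearDeriv_apply]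
  simp_rw [Matrix.trace, Matrix.diag, Matrix.mul_apply]
  rw [Finset.sum_comm]
  exact Finset.sum_congr rfl fun i _ => key i _

lemma fderiv_log_matrix_det {M : V → Matrix ι ι ℝ} {y : V}
    (hM : ∀ i j, DifferentiableAt ℝ (fun z => M z i j) y) (hdet : (M y).det ≠ 0) (v : V) :
    fderiv ℝ (fun z => Real.log (M z).det) y v = ((M y)⁻¹ * entrywiseFDeriv M y v).trace := by
  have hd : DifferentiableAt ℝ (fun z => (M z).det) y := by
    simp_rw [Matrix.det_apply']
    fun_prop
  rw [fderiv.log hd hdet, _root_.smul_apply, fderiv_matrix_det hM, Matrix.inv_def,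
    Ring.inverse_eq_inv', Matrix.smul_mul, Matrix.trace_smul]

lemma entrywiseFDeriv_inv {M : V → Matrix ι ι ℝ} {y : V}
    (hM : ∀ i j, DifferentiableAt ℝ (fun z => M z i j) y)
    (hM' : ∀ i j, DifferentiableAt ℝ (fun z => (M z)⁻¹ i j) y)
    (hdet : ∀ z, (M z).det ≠ 0) (v : V) :
    entrywiseFDeriv (fun z => (M z)⁻¹) y v
      = -((M y)⁻¹ * entrywiseFDeriv M y v * (M y)⁻¹) := by
  have hu (z : V) : IsUnit (M z).det := (hdet z).isUnit
  have h0 : entrywiseFDeriv (fun z => (M z)⁻¹) y v * M y + (M y)⁻¹ * entrywiseFDeriv M y v = 0 := by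
    ext i j
    have hc : (fun z => ∑ k, (M z)⁻¹ i k * M z k j) = fun _ => (1 : Matrix ι ι ℝ) i j := by
      funext z
      rw [← Matrix.mul_apply, Matrix.nonsing_inv_mul _ (hu z)]
    have hs : HasFDerivAt (fun z => ∑ k, (M z)⁻¹ i k * M z k j) _ y :=
      HasFDerivAt.fun_sum (u := Finset.univ) fun k _ => (hM' i k).hasFDerivAt.mul (hM k j).hasFDerivAt
    rw [hc] at hs
    have := congrArg (fun L => L v) (hs.unique (hasFDerivAt_const _ _))
    simp only [_root_.sum_apply, _root_.add_apply,
      _root_.smul_apply, smul_eq_mul, _root_.zero_apply] at this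
    simp only [Matrix.add_apply, Matrix.mul_apply, entrywiseFDeriv, Matrix.of_apply,
      Matrix.zero_apply, ← Finset.sum_add_distrib, ← this]
    exact Finset.sum_congr rfl fun k _ => by ring
  rw [← neg_mul, ← eq_neg_of_add_eq_zero_left h0, Matrix.mul_nonsing_inv_cancel_right _ _ (hu y)]

end MatrixCalculus

section Sinkhorn

variable {d : ℕ}

lemma differentiable_gradient {w : E d → ℝ} (hw : ContDiff ℝ 2 w) :
    Differentiable ℝ (gradient w) :=
  (InnerProductSpace.toDual ℝ (E d)).symm.toContinuousLinearEquiv.differentiable.comp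
    ((hw.fderiv_right (m := 1) (by norm_num)).differentiable (by norm_num))

lemma fderiv_gradient_apply {w : E d → ℝ} (hw : ContDiff ℝ 2 w) (y v : E d) (j : Fin d) :
    fderiv ℝ (gradient w) y v j = ∑ i, v i * hessian w y i j := by
  have hj : HasFDerivAt (fun z => gradient w z j)
      ((EuclideanSpace.proj j : E d →L[ℝ] ℝ).comp (fderiv ℝ (gradient w) y)) y :=
    (EuclideanSpace.proj j : E d →L[ℝ] ℝ).hasFDerivAt.comp y (differentiable_gradient hw y).hasFDerivAt
  have h2 := congrArg (fun L => L v) hj.fderiv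
  simp_rw [gradient_apply_eq_fderiv] at h2
  rw [fderiv_apply_eq_sum_coord] at h2
  simpa [hessian] using h2.symm

lemma det_hessian_ne_zero {w : E d → ℝ} (hw : ContDiff ℝ 2 w) {ψ : E d → E d}
    (hψ : Differentiable ℝ ψ) (hl : Function.LeftInverse ψ (gradient w)) (y : E d) :
    (hessian w y).det ≠ 0 := by
  have hinj : Function.Injective (fderiv ℝ (gradient w) y) := by
    have hc := (hψ (gradient w y)).hasFDerivAt.comp y (differentiable_gradient hw y).hasFDerivAt
    rw [hl.comp_eq_id] at hc
    have he := hc.unique (hasFDerivAt_id y)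
    exact Function.LeftInverse.injective fun v => congrArg (fun L => L v) he
  have hv : Function.Injective (hessian w y).vecMul := fun a b hab => by
    have h := @hinj (WithLp.toLp 2 a) (WithLp.toLp 2 b) <| by
      ext j
      simp_rw [fderiv_gradient_apply hw]
      exact congrFun hab j
    simpa using h
  exact ((Matrix.isUnit_iff_isUnit_det _).1 (Matrix.vecMul_injective_iff_isUnit.1 hv)).ne_zero

lemma contDiff_gradient_apply {φ : E d → ℝ} (hφ : ContDiff ℝ 2 φ) (j : Fin d) :
    ContDiff ℝ 1 fun z => gradient φ z j := by
  simp_rw [gradient_apply_eq_fderiv]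
  exact contDiff_fderiv_apply hφ (by norm_num) _

/-- Product rule for `e^g div (e^{-g} A ∇φ)`. -/
lemma exp_mul_divergence_mulVec_gradient {g φ : E d → ℝ} {A : E d → Matrix (Fin d) (Fin d) ℝ}
    {y : E d} (hg : DifferentiableAt ℝ g y) (hφ : ContDiff ℝ 2 φ)
    (hA : ∀ i j, DifferentiableAt ℝ (fun z => A z i j) y) :
    Real.exp (g y) * ∑ i, fderiv ℝ
        (fun z => Real.exp (-(g z)) * ((A z).mulVec fun j => gradient φ z j) i)
        y (EuclideanSpace.single i 1)
      = -fderiv ℝ g y (WithLp.toLp 2 ((A y).mulVec fun j => gradient φ y j))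
        + ∑ i, (entrywiseFDeriv A y (EuclideanSpace.single i 1)).mulVec
            (fun j => gradient φ y j) i
        + (A y * hessian φ y).trace := by
  have hterm (i : Fin d) : fderiv ℝ
      (fun z => Real.exp (-(g z)) * ((A z).mulVec fun j => gradient φ z j) i)
        y (EuclideanSpace.single i 1)
      = Real.exp (-(g y)) *
        (-(((A y).mulVec fun j => gradient φ y j) i * fderiv ℝ g y (EuclideanSpace.single i 1))
          + (entrywiseFDeriv A y (EuclideanSpace.single i 1)).mulVec (fun j => gradient φ y j) i
          + ∑ j, A y i j * hessian φ y j i) := by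
    have hsum : HasFDerivAt (fun z => ((A z).mulVec fun j => gradient φ z j) i) _ y :=
      HasFDerivAt.fun_sum (u := Finset.univ) fun j _ => (hA i j).hasFDerivAt.mul
        ((contDiff_gradient_apply hφ j).differentiable (by norm_num) y).hasFDerivAt
    have hH (j : Fin d) : fderiv ℝ (fun z => gradient φ z j) y (EuclideanSpace.single i 1)
        = hessian φ y j i := by
      rw [hessian_symm_s16 hφ]
      simp_rw [gradient_apply_eq_fderiv]
      rfl
    have hF : HasFDerivAt
        (fun z => Real.exp (-(g z)) * ((A z).mulVec fun j => gradient φ z j) i) _ y :=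
      hg.hasFDerivAt.fun_neg.exp.fun_mul hsum
    rw [hF.fderiv]
    simp only [_root_.add_apply, _root_.smul_apply, _root_.sum_apply, _root_.neg_apply, smul_eq_mul,
      hH, Finset.sum_add_distrib, Matrix.mulVec, dotProduct, entrywiseFDeriv, Matrix.of_apply]
    simp only [mul_comm (gradient φ y _)]
    ring
  have he : Real.exp (g y) * Real.exp (-(g y)) = 1 := by rw [← Real.exp_add]; simp
  simp_rw [hterm]
  rw [← Finset.mul_sum, ← mul_assoc, he, one_mul, Finset.sum_add_distrib, Finset.sum_add_distrib,
    Finset.sum_neg_distrib, fderiv_apply_eq_sum_coord g]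
  rfl

lemma sum_entrywiseFDeriv_inv_hessian_mulVec {w : E d → ℝ} (hw : ContDiff ℝ 3 w)
    (hdet : ∀ z, (hessian w z).det ≠ 0) (y : E d) (p : Fin d → ℝ) :
    ∑ i, (entrywiseFDeriv (fun z => (hessian w z)⁻¹) y (EuclideanSpace.single i 1)).mulVec p i
      = -fderiv ℝ (fun z => Real.log (hessian w z).det) y
          (WithLp.toLp 2 ((hessian w y)⁻¹.mulVec p)) := by
  have hd (i j : Fin d) : DifferentiableAt ℝ (fun z => hessian w z i j) y :=
    (contDiff_hessian_apply hw i j).differentiable (by norm_num) y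
  have hd' (i j : Fin d) : DifferentiableAt ℝ (fun z => (hessian w z)⁻¹ i j) y :=
    (contDiff_matrix_inv_apply (contDiff_hessian_apply hw) hdet i j).differentiable (by norm_num) y
  rw [fderiv_log_matrix_det hd (hdet y)]
  simp_rw [entrywiseFDeriv_inv hd hd' hdet, Matrix.neg_mulVec, ← Matrix.mulVec_mulVec]
  set u := (hessian w y)⁻¹.mulVec p
  simp only [Pi.neg_apply, Finset.sum_neg_distrib, Matrix.trace, Matrix.diag, Matrix.mul_apply]
  congr 1
  refine Finset.sum_congr rfl fun i _ => ?_
  rw [Matrix.mulVec, dotProduct]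
  refine Finset.sum_congr rfl fun k _ => ?_
  congr 1
  simp only [Matrix.mulVec, dotProduct, entrywiseFDeriv, Matrix.of_apply]
  rw [fderiv_apply_eq_sum_coord _ y (WithLp.toLp 2 u)]
  refine Finset.sum_congr rfl fun l _ => ?_
  rw [fderiv_hessian_apply_comm hw, mul_comm]
  rfl

lemma inner_gradient_comp_gradient {w h k : E d → ℝ} (hw : ContDiff ℝ 2 w) {ψ : E d → E d}
    (hψ : Differentiable ℝ ψ) (hl : Function.LeftInverse ψ (gradient w))
    (hr : Function.RightInverse ψ (gradient w)) (hk : Differentiable ℝ k)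
    (hh : ∀ y, h (gradient w y) = k y) (p y : E d) :
    ⟪p, gradient h (gradient w y)⟫
      = fderiv ℝ k y (WithLp.toLp 2 ((hessian w y)⁻¹.mulVec p)) := by
  have hhk : h = k ∘ ψ := funext fun x => by rw [Function.comp_apply, ← hh, hr x]
  have hdh : Differentiable ℝ h := hhk ▸ hk.comp hψ
  have hkh : k = h ∘ gradient w := funext fun z => (hh z).symm
  have hu : fderiv ℝ (gradient w) y (WithLp.toLp 2 ((hessian w y)⁻¹.mulVec p)) = p := by
    ext j
    rw [fderiv_gradient_apply hw]
    have hmul : (hessian w y).mulVec ((hessian w y)⁻¹.mulVec p) = p := by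
      rw [Matrix.mulVec_mulVec,
        Matrix.mul_nonsing_inv _ (det_hessian_ne_zero hw hψ hl y).isUnit, Matrix.one_mulVec]
    rw [← congrFun hmul j]
    exact Finset.sum_congr rfl fun i _ => by rw [hessian_symm_s16 hw, mul_comm]
  rw [hkh, fderiv_comp y (hdh _) (differentiable_gradient hw y), ContinuousLinearMap.comp_apply, hu,
    ← toDual_gradient, InnerProductSpace.toDual_apply_apply, real_inner_comm]

end Sinkhorn

/-- Let `w` be a `C³` strictly convex function with `∇w` a
diffeomorphism of `ℝ^d`, let `g` be `C¹` with `e^{-g}` a probability density,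
and let `h` satisfy `h(∇w(y)) = g(y) + log det ∇²w(y)` (so `e^{-h}` is the
pushforward of `e^{-g}` by `∇w`).  Then for every `φ ∈ C²` and every `y`, the
Sinkhorn-diffusion generator has the divergence form
`-⟨∇φ(y), ∇h(∇w(y))⟩ + tr((∇²w(y))⁻¹ ∇²φ(y))
  = e^{g(y)} div( e^{-g} (∇²w)⁻¹ ∇φ )(y)`,
and consequently, if `φ` is compactly supported, the integral of the generator
against `e^{-g}` vanishes, i.e. `e^{-g}` is a stationary distribution. -/
theorem sinkhorn_generator_divergence_form_and_stationarity
    {d : ℕ} (g w h : E d → ℝ)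
    (hw : ContDiff ℝ 3 w)
    (hconv : StrictConvexOn ℝ Set.univ w)
    (hdiffeo : ∃ ψ : E d → E d, ContDiff ℝ 2 ψ ∧
        Function.LeftInverse ψ (gradient w) ∧ Function.RightInverse ψ (gradient w))
    (hg : ContDiff ℝ 1 g)
    (hprob : ∫ y : E d, Real.exp (-(g y)) = 1)
    (hh : ∀ y : E d, h (gradient w y) = g y + Real.log (hessian w y).det) :
    ∀ φ : E d → ℝ, ContDiff ℝ 2 φ →
      (∀ y : E d,
        -⟪gradient φ y, gradient h (gradient w y)⟫
            + Matrix.trace ((hessian w y)⁻¹ * hessian φ y)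
          = Real.exp (g y) *
              ∑ i : Fin d,
                fderiv ℝ
                  (fun z =>
                    Real.exp (-(g z)) *
                      ((hessian w z)⁻¹.mulVec fun j => gradient φ z j) i)
                  y (EuclideanSpace.single i 1)) ∧
      (HasCompactSupport φ →
        (∫ y : E d,
            (-⟪gradient φ y, gradient h (gradient w y)⟫
              + Matrix.trace ((hessian w y)⁻¹ * hessian φ y)) * Real.exp (-(g y)))
          = 0) := by
  intro φ hφ
  obtain ⟨ψ, hψ, hl, hr⟩ := hdiffeo
  have hψd : Differentiable ℝ ψ := hψ.differentiable (by norm_num)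
  have hw2 : ContDiff ℝ 2 w := hw.of_le (by norm_num)
  have hdet := det_hessian_ne_zero hw2 hψd hl
  have hA : ∀ i j, ContDiff ℝ 1 fun z => (hessian w z)⁻¹ i j :=
    contDiff_matrix_inv_apply (contDiff_hessian_apply hw) hdet
  have hgd : Differentiable ℝ g := hg.differentiable (by norm_num)
  have hlog : Differentiable ℝ fun y => Real.log (hessian w y).det :=
    ((contDiff_matrix_det (contDiff_hessian_apply hw)).differentiable (by norm_num)).log hdet
  have hdiv : ∀ y : E d,
      -⟪gradient φ y, gradient h (gradient w y)⟫ + Matrix.trace ((hessian w y)⁻¹ * hessian φ y)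
        = Real.exp (g y) * ∑ i : Fin d, fderiv ℝ
            (fun z => Real.exp (-(g z)) * ((hessian w z)⁻¹.mulVec fun j => gradient φ z j) i)
            y (EuclideanSpace.single i 1) := fun y => by
    rw [exp_mul_divergence_mulVec_gradient (hgd y) hφ fun i j =>
        (hA i j).differentiable (by norm_num) y,
      sum_entrywiseFDeriv_inv_hessian_mulVec hw hdet,
      inner_gradient_comp_gradient hw2 hψd hl hr (hgd.fun_add hlog) hh,
      fderiv_fun_add (hgd y) (hlog y), _root_.add_apply, neg_add]
  refine ⟨hdiv, fun hc => ?_⟩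
  have hF (i : Fin d) : ContDiff ℝ 1 fun z =>
      Real.exp (-(g z)) * ((hessian w z)⁻¹.mulVec fun j => gradient φ z j) i :=
    hg.neg.exp.mul <| by
      simp only [Matrix.mulVec, dotProduct]
      exact ContDiff.sum fun j _ => (hA i j).mul (contDiff_gradient_apply hφ j)
  have hFc (i : Fin d) : HasCompactSupport fun z =>
      Real.exp (-(g z)) * ((hessian w z)⁻¹.mulVec fun j => gradient φ z j) i := by
    refine (hc.fderiv ℝ).mono fun z hz => ?_
    contrapose! hz
    have h0 : fderiv ℝ φ z = 0 := Function.notMem_support.1 hz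
    simp [Matrix.mulVec, dotProduct, gradient_apply_eq_fderiv, h0]
  have hcancel (y : E d) (s : ℝ) : Real.exp (g y) * s * Real.exp (-(g y)) = s := by
    rw [mul_right_comm, ← Real.exp_add, add_neg_cancel, Real.exp_zero, one_mul]
  simp_rw [hdiv, hcancel]
  rw [integral_finsetSum]
  · exact Finset.sum_eq_zero fun i _ => integral_fderiv_apply_eq_zero (hF i) (hFc i) _
  · intro i _
    exact (contDiff_fderiv_apply (m := 0) (hF i) (by norm_num)
      _).continuous.integrable_of_hasCompactSupport ((hFc i).fderiv_apply ℝ _)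
end
end

section
/- Let g : ℝ^d → ℝ be such that e^{-g} is a probability density. Let (u_t)_{t≥0} be a family of C² strictly convex functions on ℝ^d such that ∇u_t is a diffeomorphism with inverse ∇w_t, the map (t,x) ↦ ∇u_t(x) is C¹ with ∂_t ∇u_t(x) = ∇ψ_t(x) for a family of C¹ functions ψ_t : ℝ^d → ℝ, and (t,y) ↦ ∇w_t(y) is C¹ with ∂_t ∇w_t bounded on [0,T]×ℝ^d for each T > 0. Let ρ_t be the pushforward of the measure e^{-g(y)} dy by ∇w_t. Then ρ_t is a weak solution of the continuity equation with the mirror velocity field: for every smooth compactly supported ξ : ℝ^d → ℝ and every t > 0, d/dt ∫ ξ dρ_t = − ∫ ⟨ ∇ξ(x), (∇²u_t(x))^{-1} ∇ψ_t(x) ⟩ dρ_t(x). -/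
open MeasureTheory Filter
open scoped RealInnerProductSpace BigOperators Topology

noncomputable section

/-- The measure with density `e^{-g}` with respect to Lebesgue measure. -/
def expMeasure {d : ℕ} (g : E d → ℝ) : Measure (E d) :=
  volume.withDensity fun y => ENNReal.ofReal (Real.exp (-(g y)))

/-- `e^{-g}` integrates to one, so the measure it defines is finite. -/
lemma isFiniteMeasure_expMeasure {d : ℕ} {g : E d → ℝ}
    (hprob : ∫ y : E d, Real.exp (-(g y)) = 1) : IsFiniteMeasure (expMeasure g) :=
  isFiniteMeasure_withDensity_ofReal
    (Integrable.of_integral_ne_zero (by rw [hprob]; exact one_ne_zero)).2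

/-- Coordinates of the gradient are partial derivatives. -/
lemma gradient_apply {d : ℕ} (φ : E d → ℝ) (x : E d) (i : Fin d) :
    gradient φ x i = fderiv ℝ φ x (EuclideanSpace.single i 1) := by
  rw [← inner_gradient_left, EuclideanSpace.inner_single_right]
  simp

/-- The derivative along `v` is the coordinate sum `∑ ∂ᵢφ vᵢ`. -/
lemma fderiv_eq_sum_gradient {d : ℕ} (φ : E d → ℝ) (x v : E d) :
    fderiv ℝ φ x v = ∑ i, gradient φ x i * v i := by
  rw [← inner_gradient_left, PiLp.inner_apply]
  simp [mul_comm]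

/-- The Hessian matrix of a `C²` function represents the derivative of its gradient. -/
lemma hessian_mulVec {d : ℕ} {φ : E d → ℝ} (hφ : ContDiff ℝ 2 φ) (x v : E d) (i : Fin d) :
    (hessian φ x).mulVec v i = fderiv ℝ (gradient φ) x v i := by
  have hd : DifferentiableAt ℝ (fderiv ℝ φ) x :=
    (hφ.fderiv_right (m := 1) (by norm_num)).differentiable one_ne_zero x
  have hpart : ∀ a b : E d, fderiv ℝ (fun z => fderiv ℝ φ z a) x b
      = fderiv ℝ (fderiv ℝ φ) x b a := fun a b => by
    rw [fderiv_clm_apply hd (differentiableAt_const a)]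
    simp
  have hsymm : IsSymmSndFDerivAt ℝ φ x :=
    hφ.contDiffAt.isSymmSndFDerivAt (by simp)
  have hgd : DifferentiableAt ℝ (gradient φ) x :=
    ((InnerProductSpace.toDual ℝ (E d)).symm.toContinuousLinearEquiv.differentiableAt).comp x hd
  have hcoord : fderiv ℝ (gradient φ) x v i
      = fderiv ℝ (fderiv ℝ φ) x v (EuclideanSpace.single i 1) := by
    rw [← hpart]
    simp_rw [← gradient_apply]
    have h := ((EuclideanSpace.proj i : E d →L[ℝ] ℝ).hasFDerivAt.comp x
      hgd.hasFDerivAt).fderiv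
    exact (congrArg (fun L : E d →L[ℝ] ℝ => L v) h).symm
  rw [hcoord, ← hpart, fderiv_eq_sum_gradient]
  change ∑ j, hessian φ x i j * v j = _
  refine Finset.sum_congr rfl fun j _ => ?_
  rw [gradient_apply, hpart, hessian, hpart, hsymm.eq]

/-- If `∇φ` has a differentiable left inverse, the Hessian matrix of `φ` is invertible. -/
lemma isUnit_hessian {d : ℕ} {φ : E d → ℝ} {G : E d → E d} (hφ : ContDiff ℝ 2 φ)
    (hgrad : Differentiable ℝ (gradient φ)) (hG : Differentiable ℝ G)
    (hleft : Function.LeftInverse G (gradient φ)) (x : E d) : IsUnit (hessian φ x) := by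
  have hcomp := ((hG _).hasFDerivAt.comp x (hgrad x).hasFDerivAt)
  rw [hleft.comp_eq_id] at hcomp
  have hid := hcomp.unique (hasFDerivAt_id x)
  rw [← Matrix.mulVec_injective_iff_isUnit, ← Matrix.coe_mulVecLin, injective_iff_map_eq_zero]
  intro v hv
  have h0 : fderiv ℝ (gradient φ) x (WithLp.toLp 2 v) = 0 := by
    ext i
    rw [← hessian_mulVec hφ]
    exact congrFun hv i
  have h1 := congrArg (fun L : E d →L[ℝ] E d => L (WithLp.toLp 2 v)) hid
  simp only [ContinuousLinearMap.comp_apply, h0, map_zero, ContinuousLinearMap.id_apply] at h1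
  exact (congrArg (WithLp.ofLp (p := 2)) h1).symm

/-- Differentiating `U t (W t y) = y` in time. -/
lemma deriv_time_add_fderiv_eq_zero {F : Type*} [NormedAddCommGroup F] [NormedSpace ℝ F]
    {U : ℝ → F → F} {W : ℝ → F} {y : F} {t : ℝ}
    (hU : DifferentiableAt ℝ (fun p : ℝ × F => U p.1 p.2) (t, W t))
    (hW : DifferentiableAt ℝ W t) (hinv : ∀ s, U s (W s) = y) :
    deriv (fun s => U s (W t)) t + fderiv ℝ (U t) (W t) (deriv W t) = 0 := by
  set L := fderiv ℝ (fun p : ℝ × F => U p.1 p.2) (t, W t)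
  have h1 : HasDerivAt (fun s => U s (W s)) (L (1, deriv W t)) t :=
    hU.hasFDerivAt.comp_hasDerivAt (f := fun s => (s, W s)) t
      ((hasDerivAt_id t).prodMk hW.hasDerivAt)
  have h2 : HasDerivAt (fun s => U s (W t)) (L (1, 0)) t :=
    hU.hasFDerivAt.comp_hasDerivAt (f := fun s => (s, W t)) t
      ((hasDerivAt_id t).prodMk (hasDerivAt_const t (W t)))
  have h3 : HasFDerivAt (U t) (L.comp (ContinuousLinearMap.inr ℝ ℝ F)) (W t) :=
    hU.hasFDerivAt.comp (f := fun x => (t, x)) (W t) (hasFDerivAt_prodMk_right t (W t))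
  have h4 : L (1, deriv W t) = 0 := by
    simp only [hinv] at h1
    exact h1.unique (hasDerivAt_const t y)
  rw [h2.deriv, h3.fderiv, ContinuousLinearMap.comp_apply, ContinuousLinearMap.inr_apply,
    ← map_add, Prod.mk_add_mk, add_zero, zero_add, h4]

/-- Let `e^{-g}` be a probability density and `(u_t)` a family
of `C²` strictly convex functions with `∇u_t` a diffeomorphism with inverse
`∇w_t`, `(t,x) ↦ ∇u_t(x)` being `C¹` with `∂ₜ∇u_t(x) = ∇ψ_t(x)` for a family of
`C¹` functions `ψ_t`, and `(t,y) ↦ ∇w_t(y)` being `C¹` with `∂ₜ∇w_t` bounded on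
`[0,T]×ℝ^d` for each `T > 0`.  Let `ρ_t = (∇w_t)_# (e^{-g} dy)`.  Then `ρ_t` is
a weak solution of the continuity equation with the mirror velocity field
`(∇²u_t)⁻¹ ∇ψ_t`: for all smooth compactly supported `ξ` and all `t > 0`,
`d/dt ∫ ξ dρ_t = - ∫ ⟨∇ξ(x), (∇²u_t(x))⁻¹ ∇ψ_t(x)⟩ dρ_t(x)`. -/
theorem mirror_flow_weak_continuity_equation
    {d : ℕ} (g : E d → ℝ) (u w ψ : ℝ → E d → ℝ)
    (hprob : ∫ y : E d, Real.exp (-(g y)) = 1)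
    (hu : ∀ t : ℝ, ContDiff ℝ 2 (u t))
    (hconv : ∀ t : ℝ, StrictConvexOn ℝ Set.univ (u t))
    (hinv_left : ∀ t : ℝ, Function.LeftInverse (gradient (w t)) (gradient (u t)))
    (hinv_right : ∀ t : ℝ, Function.RightInverse (gradient (w t)) (gradient (u t)))
    (hjoint_u : ContDiff ℝ 1 fun p : ℝ × E d => gradient (u p.1) p.2)
    (hψ : ∀ t : ℝ, ContDiff ℝ 1 (ψ t))
    (hdt : ∀ t : ℝ, ∀ x : E d, deriv (fun s => gradient (u s) x) t = gradient (ψ t) x)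
    (hjoint_w : ContDiff ℝ 1 fun p : ℝ × E d => gradient (w p.1) p.2)
    (hbdd : ∀ T : ℝ, 0 < T → ∃ M : ℝ, ∀ t ∈ Set.Icc (0:ℝ) T, ∀ y : E d,
        ‖deriv (fun s => gradient (w s) y) t‖ ≤ M) :
    ∀ ξ : E d → ℝ, ContDiff ℝ (⊤ : ℕ∞) ξ → HasCompactSupport ξ → ∀ t : ℝ, 0 < t →
      deriv
          (fun s => ∫ x : E d, ξ x ∂(Measure.map (gradient (w s)) (expMeasure g))) t
        = - ∫ x : E d,
              (∑ i : Fin d,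
                gradient ξ x i *
                  ((hessian (u t) x)⁻¹.mulVec fun j => gradient (ψ t) x j) i)
            ∂(Measure.map (gradient (w t)) (expMeasure g)) := by
  intro ξ hξ hξc t ht
  have := isFiniteMeasure_expMeasure hprob
  have hWc : ∀ s, Continuous (gradient (w s)) := fun s =>
    hjoint_w.continuous.comp (Continuous.prodMk_right s)
  have hUc : ∀ s, Continuous (gradient (u s)) := fun s =>
    hjoint_u.continuous.comp (Continuous.prodMk_right s)
  have hUd : ∀ s, Differentiable ℝ (gradient (u s)) := fun s =>
    (hjoint_u.differentiable one_ne_zero).comp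
      (g := fun p : ℝ × E d => gradient (u p.1) p.2) (f := fun x => (s, x)) (by fun_prop)
  have hWd : ∀ s, Differentiable ℝ (gradient (w s)) := fun s =>
    (hjoint_w.differentiable one_ne_zero).comp
      (g := fun p : ℝ × E d => gradient (w p.1) p.2) (f := fun x => (s, x)) (by fun_prop)
  have hWt : ∀ s y, DifferentiableAt ℝ (fun r => gradient (w r) y) s := fun s y =>
    ((hjoint_w.differentiable one_ne_zero).comp
      (g := fun p : ℝ × E d => gradient (w p.1) p.2) (f := fun r => (r, y)) (by fun_prop)) s
  have hemb : ∀ s, MeasurableEmbedding (gradient (w s)) := fun s =>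
    (Homeomorph.mk ⟨gradient (w s), gradient (u s), hinv_right s, hinv_left s⟩
      (hWc s) (hUc s)).measurableEmbedding
  simp_rw [(hemb _).integral_map]
  have hξd : Differentiable ℝ ξ := hξ.differentiable (by simp)
  have hchain : ∀ s y, HasDerivAt (fun r => ξ (gradient (w r) y))
      (fderiv ℝ ξ (gradient (w s) y) (deriv (fun r => gradient (w r) y) s)) s := fun s y =>
    (hξd _).hasFDerivAt.comp_hasDerivAt s (hWt s y).hasDerivAt
  have hξ' : Continuous (fderiv ℝ ξ) := hξ.continuous_fderiv (by simp)
  obtain ⟨M, hM⟩ := hbdd (t + 1) (by linarith)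
  obtain ⟨C, hC⟩ := (hξc.fderiv (𝕜 := ℝ)).exists_bound_of_continuous hξ'
  obtain ⟨B, hB⟩ := hξc.exists_bound_of_continuous hξ.continuous
  have hWt_cont : Continuous fun y => deriv (fun r => gradient (w r) y) t := by
    have h : ∀ y, deriv (fun r => gradient (w r) y) t
        = fderiv ℝ (fun p : ℝ × E d => gradient (w p.1) p.2) (t, y) (1, 0) := fun y =>
      ((hjoint_w.differentiable one_ne_zero (t, y)).hasFDerivAt.comp_hasDerivAt
        (f := fun r => (r, y)) t
        ((hasDerivAt_id t).prodMk (hasDerivAt_const t y))).deriv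
    simp_rw [h]
    exact ((hjoint_w.continuous_fderiv one_ne_zero).comp
      (Continuous.prodMk_right t)).clm_apply continuous_const
  have hmain := (hasDerivAt_integral_of_dominated_loc_of_deriv_le
    (μ := expMeasure g) (F := fun s y => ξ (gradient (w s) y))
    (F' := fun s y => fderiv ℝ ξ (gradient (w s) y) (deriv (fun r => gradient (w r) y) s))
    (x₀ := t) (s := Set.Icc 0 (t + 1)) (bound := fun _ => C * M)
    (Icc_mem_nhds ht (by linarith))
    (Eventually.of_forall fun s => (hξ.continuous.comp (hWc s)).aestronglyMeasurable)
    (Integrable.of_bound (hξ.continuous.comp (hWc t)).aestronglyMeasurable B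
      (Eventually.of_forall fun y => hB _))
    ((hξ'.comp (hWc t)).clm_apply hWt_cont).aestronglyMeasurable
    (Eventually.of_forall fun y s hs =>
      (ContinuousLinearMap.le_opNorm _ _).trans
        (mul_le_mul (hC _) (hM s hs y) (norm_nonneg _) ((norm_nonneg _).trans (hC 0))))
    (integrable_const _)
    (Eventually.of_forall fun y s _ => hchain s y)).2
  rw [hmain.deriv, ← integral_neg]
  refine integral_congr_ae (Eventually.of_forall fun y => ?_)
  set x := gradient (w t) y
  set v := deriv (fun r => gradient (w r) y) t
  have hflow : gradient (ψ t) x + fderiv ℝ (gradient (u t)) x v = 0 := by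
    rw [← hdt]
    exact deriv_time_add_fderiv_eq_zero (U := fun s => gradient (u s))
      (W := fun s => gradient (w s) y) (hjoint_u.differentiable one_ne_zero _) (hWt t y)
      (fun s => hinv_right s y)
  have hdet : IsUnit (hessian (u t) x).det :=
    (Matrix.isUnit_iff_isUnit_det _).1
      (isUnit_hessian (hu t) (hUd t) (hWd t) (hinv_left t) x)
  have hgradψ : (fun j => gradient (ψ t) x j) = (hessian (u t) x).mulVec (-v).ofLp := by
    ext j
    rw [hessian_mulVec (hu t), map_neg, ← eq_neg_of_add_eq_zero_left hflow]
  dsimp only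
  rw [hgradψ, Matrix.mulVec_mulVec, Matrix.nonsing_inv_mul _ hdet, Matrix.one_mulVec,
    fderiv_eq_sum_gradient]
  simp [v]
end
end

section
/- Let ε > 0 and consider Sinkhorn iterates u_{k+1}^ε := S^ε[u_k^ε] with iterate marginal densities ρ_{k+1}^ε(x) := exp( (u_{k+1}^ε(x) − u_k^ε(x))/ε − f(x) ) (probability densities). Then, provided the integral below is well defined, the average potential increment under e^{-f} is minus ε times a relative entropy, hence non-positive: ∫_{ℝ^d} ( u_{k+1}^ε(x) − u_k^ε(x) ) e^{-f(x)} dx = −ε · KL( e^{-f} ‖ ρ_{k+1}^ε ) ≤ 0. -/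
open MeasureTheory Filter
open scoped RealInnerProductSpace BigOperators Topology

noncomputable section

/-- Sinkhorn operator `V^ε[u](y) = ε log ∫ exp((⟨x,y⟩ - u(x))/ε - f(x)) dx`. -/
def Vop {d : ℕ} (f : E d → ℝ) (ε : ℝ) (u : E d → ℝ) (y : E d) : ℝ :=
  ε * Real.log (∫ x : E d, Real.exp ((⟪x, y⟫ - u x) / ε - f x))

/-- Sinkhorn operator `U^ε[v](x) = ε log ∫ exp((⟨x,y⟩ - v(y))/ε - g(y)) dy`. -/
def Uop {d : ℕ} (g : E d → ℝ) (ε : ℝ) (v : E d → ℝ) (x : E d) : ℝ :=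
  ε * Real.log (∫ y : E d, Real.exp ((⟪x, y⟫ - v y) / ε - g y))

/-- The double-step Sinkhorn operator `S^ε = U^ε ∘ V^ε`. -/
def Sop {d : ℕ} (f g : E d → ℝ) (ε : ℝ) (u : E d → ℝ) : E d → ℝ :=
  Uop g ε (Vop f ε u)

/-- Kullback–Leibler divergence between two densities on `ℝ^d`:
`KL(p‖q) = ∫ p log(p/q)`. -/
def KLdiv {d : ℕ} (p q : E d → ℝ) : ℝ :=
  ∫ x : E d, p x * Real.log (p x / q x)

/-- For Sinkhorn iterates `u' = S^ε[u]` with iterate marginal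
density `ρ(x) = exp((u'(x) - u(x))/ε - f(x))` (a probability density), provided
the integral is well defined, the average potential increment under `e^{-f}` is
`∫ (u' - u) e^{-f} = -ε·KL(e^{-f} ‖ ρ) ≤ 0`. -/
theorem sinkhorn_average_increment_is_neg_KL
    {d : ℕ} (f g : E d → ℝ) (ε : ℝ) (u u' : E d → ℝ)
    (hε : 0 < ε)
    (hprob_f : ∫ x : E d, Real.exp (-(f x)) = 1)
    (hprob_g : ∫ y : E d, Real.exp (-(g y)) = 1)
    (hstep : u' = Sop f g ε u)
    (hρ_prob : ∫ x : E d, Real.exp ((u' x - u x) / ε - f x) = 1)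
    (hint : Integrable fun x : E d => (u' x - u x) * Real.exp (-(f x))) :
    (∫ x : E d, (u' x - u x) * Real.exp (-(f x)))
        = -ε * KLdiv (fun x => Real.exp (-(f x)))
            (fun x => Real.exp ((u' x - u x) / ε - f x)) ∧
    (∫ x : E d, (u' x - u x) * Real.exp (-(f x))) ≤ 0 := by
  have hf_int : Integrable fun x : E d => Real.exp (-(f x)) :=
    .of_integral_ne_zero (by rw [hprob_f]; exact one_ne_zero)
  have hρ_int : Integrable fun x : E d => Real.exp ((u' x - u x) / ε - f x) :=
    .of_integral_ne_zero (by rw [hρ_prob]; exact one_ne_zero)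
  constructor
  · rw [KLdiv, ← integral_const_mul]
    refine integral_congr_ae (.of_forall fun x => ?_)
    simp only [← Real.exp_sub, Real.log_exp]
    field_simp
    ring
  · have hle : ∫ x : E d, (u' x - u x) * Real.exp (-(f x)) ≤
        ∫ x : E d, ε * (Real.exp ((u' x - u x) / ε - f x) - Real.exp (-(f x))) := by
      refine integral_mono hint ((hρ_int.sub hf_int).const_mul ε) fun x => ?_
      have hw : u' x - u x = ε * ((u' x - u x) / ε) := by field_simp
      have hmul := mul_le_mul_of_nonneg_right (Real.add_one_le_exp ((u' x - u x) / ε))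
        (Real.exp_pos (-(f x))).le
      rw [← Real.exp_add, ← sub_eq_add_neg] at hmul
      calc (u' x - u x) * Real.exp (-(f x))
          = ε * ((u' x - u x) / ε * Real.exp (-(f x))) := by rw [← mul_assoc, ← hw]
        _ ≤ _ := mul_le_mul_of_nonneg_left (by linarith) hε.le
    rwa [integral_const_mul, integral_sub hρ_int hf_int, hρ_prob, hprob_f, sub_self,
      mul_zero] at hle
end
end

section
/- For η ∈ (0,1) and t ≥ 0, define σ_F²(t) := 1 − (1−η²)e^{−2t} and σ_S²(t) := ( 1 − 2(1−η) / ( e^{2t/η}(η+1) + (1−η) ) )². Then 1 − σ_S²(t) > 0 and (1 − σ_F²(t)) / (1 − σ_S²(t)) ≥ ((1+η)²/4) · exp( 2t(1/η − 1) ); in particular this ratio tends to infinity as t → ∞, so the Sinkhorn flow variance converges to 1 strictly faster than the Fokker–Planck flow variance in the Gaussian scale example. -/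
open Filter
open scoped Topology

noncomputable section

/-- Variance of the Fokker–Planck flow in the Gaussian scale example. -/
def sigmaF (η t : ℝ) : ℝ := 1 - (1 - η ^ 2) * Real.exp (-2 * t)

/-- Variance of the Sinkhorn flow in the Gaussian scale example. -/
def sigmaS (η t : ℝ) : ℝ :=
  (1 - 2 * (1 - η) / (Real.exp (2 * t / η) * (η + 1) + (1 - η))) ^ 2

/-- Closed form of the distance of the Sinkhorn flow variance to its limit. -/
theorem one_sub_sigmaS {η : ℝ} (hη : η ∈ Set.Ioo (0:ℝ) 1) (t : ℝ) :
    1 - sigmaS η t = 4 * (1 - η ^ 2) * Real.exp (2 * t / η) /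
      (Real.exp (2 * t / η) * (η + 1) + (1 - η)) ^ 2 := by
  obtain ⟨h0, h1⟩ := hη
  have hE := Real.exp_pos (2 * t / η)
  unfold sigmaS
  generalize Real.exp (2 * t / η) = E at *
  have hD : E * (η + 1) + (1 - η) ≠ 0 := by
    have : 0 < E * (η + 1) := by positivity
    linarith
  field_simp
  ring

theorem one_sub_sigmaS_pos {η : ℝ} (hη : η ∈ Set.Ioo (0:ℝ) 1) (t : ℝ) :
    0 < 1 - sigmaS η t := by
  rw [one_sub_sigmaS hη]
  obtain ⟨h0, h1⟩ := hη
  have h2 : 0 < 1 - η ^ 2 := by nlinarith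
  have h3 : 0 < 1 - η := by linarith
  positivity

theorem exp_le_variance_ratio {η : ℝ} (hη : η ∈ Set.Ioo (0:ℝ) 1) (t : ℝ) :
    ((1 + η) ^ 2 / 4) * Real.exp (2 * t * (1 / η - 1))
      ≤ (1 - sigmaF η t) / (1 - sigmaS η t) := by
  rw [le_div_iff₀ (one_sub_sigmaS_pos hη t), one_sub_sigmaS hη]
  obtain ⟨h0, h1⟩ := hη
  have h2 : 0 < 1 - η ^ 2 := by nlinarith
  have h3 : 0 < 1 - η := by linarith
  have hsplit : Real.exp (2 * t * (1 / η - 1)) =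
      Real.exp (2 * t / η) * Real.exp (-2 * t) := by
    rw [← Real.exp_add]
    ring_nf
  rw [hsplit, sigmaF]
  have hE := Real.exp_pos (2 * t / η)
  have hF := Real.exp_pos (-2 * t)
  generalize Real.exp (2 * t / η) = E at *
  generalize Real.exp (-2 * t) = F at *
  have hD : (E * (η + 1)) ^ 2 ≤ (E * (η + 1) + (1 - η)) ^ 2 := by
    gcongr
    linarith
  calc (1 + η) ^ 2 / 4 * (E * F) *
        (4 * (1 - η ^ 2) * E / (E * (η + 1) + (1 - η)) ^ 2)
      = (1 - η ^ 2) * F * ((E * (η + 1)) ^ 2 / (E * (η + 1) + (1 - η)) ^ 2) := by ring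
    _ ≤ (1 - η ^ 2) * F * 1 := by
      gcongr
      exact div_le_one_of_le₀ hD (sq_nonneg _)
    _ = 1 - (1 - (1 - η ^ 2) * F) := by ring

/-- For `η ∈ (0,1)` and `t ≥ 0`, `1 - σ_S²(t) > 0` and
`(1 - σ_F²(t)) / (1 - σ_S²(t)) ≥ ((1+η)²/4)·exp(2t(1/η - 1))`; in particular
the ratio tends to infinity as `t → ∞`, i.e. the Sinkhorn flow variance
converges to `1` strictly faster than the Fokker–Planck one. -/
theorem gaussian_scale_sinkhorn_faster_than_fokker_planck
    (η : ℝ) (hη : η ∈ Set.Ioo (0:ℝ) 1) :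
    (∀ t : ℝ, 0 ≤ t →
      0 < 1 - sigmaS η t ∧
      ((1 + η) ^ 2 / 4) * Real.exp (2 * t * (1 / η - 1))
        ≤ (1 - sigmaF η t) / (1 - sigmaS η t)) ∧
    Tendsto (fun t => (1 - sigmaF η t) / (1 - sigmaS η t)) atTop atTop := by
  refine ⟨fun t _ => ⟨one_sub_sigmaS_pos hη t, exp_le_variance_ratio hη t⟩,
    tendsto_atTop_mono (exp_le_variance_ratio hη) ?_⟩
  obtain ⟨h0, h1⟩ := hη
  have hrate : 0 < 1 / η - 1 := sub_pos.mpr (one_lt_one_div h0 h1)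
  exact (Real.tendsto_exp_atTop.comp
    ((tendsto_id.const_mul_atTop two_pos).atTop_mul_const hrate)).const_mul_atTop
      (by positivity)
end
end
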